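/- For λ > 0 define the weight sequence w_n(λ) = √((n+1)/(λ+n)) for n ≥ 0 (these are the weights of the backward weighted shift unitarily equivalent to the adjoint of multiplication by z on the reproducing kernel Hilbert space on the unit disk with kernel (1 − z·conj(w))^{−λ}). Let λ₁, λ₂ > 0 with λ₂ − λ₁ < 2, let (e_n)_{n≥0} be an orthonormal basis of a complex separable Hilbert space H, and let A, B be the bounded operators determined by Ae₀ = Be₀ = 0, Ae_{n+1} = w_n(λ₁)·e_n, Be_{n+1} = w_n(λ₂)·e_n for n ≥ 0. Then the pair (A, B) satisfies Property (H). -/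

import Mathlib

/-- A pair `(T₁, T₂)` of bounded linear operators satisfies Property (H) if every bounded
operator `X : H₂ → H₁` such that `T₁X = XT₂` and `X = T₁Z − ZT₂` for some bounded operator
`Z : H₂ → H₁` is necessarily the zero operator. -/
def PropertyH {H₁ H₂ : Type*} [NormedAddCommGroup H₁] [InnerProductSpace ℂ H₁]
    [NormedAddCommGroup H₂] [InnerProductSpace ℂ H₂]
    (T₁ : H₁ →L[ℂ] H₁) (T₂ : H₂ →L[ℂ] H₂) : Prop :=
  ∀ X : H₂ →L[ℂ] H₁, T₁.comp X = X.comp T₂ →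
    (∃ Z : H₂ →L[ℂ] H₁, X = T₁.comp Z - Z.comp T₂) → X = 0

/-- The weights of the backward weighted shift unitarily equivalent to the adjoint of
multiplication by `z` on the reproducing kernel Hilbert space with kernel
`(1 - z·conj w)^{-λ}`. -/
noncomputable def wSeq (lam : ℝ) (n : ℕ) : ℝ := Real.sqrt ((n + 1) / (lam + n))

open Filter

theorem wSeq_pos {lam : ℝ} (h : 0 < lam) (n : ℕ) : 0 < wSeq lam n :=
  Real.sqrt_pos.2 (by positivity)

theorem wSeq_sq {lam : ℝ} (h : 0 < lam) (n : ℕ) :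
    wSeq lam n ^ 2 = (n + 1) / (lam + n) :=
  Real.sq_sqrt (by positivity)

theorem tendsto_atTop_of_one_add_div_mul_le {y : ℕ → ℝ} {ε : ℝ} {N : ℕ} (hε : 0 < ε)
    (hN : 0 < y N) (hy : ∀ n ≥ N, (1 + ε / (n + 1)) * y n ≤ y (n + 1)) :
    Tendsto y atTop atTop := by
  have hmono : ∀ n ≥ N, y N ≤ y n := by
    intro n hn
    induction n, hn using Nat.le_induction with
    | base => exact le_rfl
    | succ n hn ih =>
      have h0 : 0 ≤ ε / ((n : ℝ) + 1) * y n := mul_nonneg (by positivity) (by linarith)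
      linarith [hy n hn]
  have hsum : ∀ n ≥ N, y N + ε * y N * (∑ i ∈ Finset.range n, 1 / ((i : ℝ) + 1) -
      ∑ i ∈ Finset.range N, 1 / ((i : ℝ) + 1)) ≤ y n := by
    intro n hn
    induction n, hn using Nat.le_induction with
    | base => simp
    | succ n hn ih =>
      rw [Finset.sum_range_succ]
      have h0 : ε / ((n : ℝ) + 1) * y N ≤ ε / ((n : ℝ) + 1) * y n :=
        mul_le_mul_of_nonneg_left (hmono n hn) (by positivity)
      have h1 : ε / ((n : ℝ) + 1) * y N = ε * y N * (1 / ((n : ℝ) + 1)) := by ring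
      linarith [hy n hn]
  refine tendsto_atTop_mono' atTop (eventually_atTop.2 ⟨N, hsum⟩) ?_
  refine tendsto_atTop_add_const_left _ _ (Tendsto.const_mul_atTop (mul_pos hε hN) ?_)
  exact tendsto_atTop_add_const_right _ _ Real.tendsto_sum_range_one_div_nat_succ_atTop

/-- Along a diagonal of an intertwiner of the two shifts, linear growth of a multiple of the
entries is compatible with boundedness only if the entries vanish. -/
theorem eq_zero_of_wSeq_recurrence {lam₁ lam₂ : ℝ} (h₁ : 0 < lam₁) (h₂ : 0 < lam₂)
    (hdiff : lam₂ - lam₁ < 2) (d : ℕ) {x : ℕ → ℂ}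
    (hx : ∀ n, (wSeq lam₁ n : ℂ) * x (n + 1) = (wSeq lam₂ (n + d) : ℂ) * x n)
    {c : ℂ} {C : ℝ} (hC : ∀ n : ℕ, ‖x n * (c + n)‖ ≤ C) : x 0 = 0 := by
  by_contra hx0
  have hne : ∀ n, x n ≠ 0 := by
    intro n
    induction n with
    | zero => exact hx0
    | succ n ih =>
      intro h
      have := hx n
      rw [h, mul_zero, eq_comm, mul_eq_zero] at this
      exact this.elim (fun h => (wSeq_pos h₂ _).ne' (by exact_mod_cast h)) ih
  have hsq : ∀ n : ℕ, ((n : ℝ) + 1) * (lam₂ + (n + d)) * ‖x (n + 1)‖ ^ 2 =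
      (n + d + 1) * (lam₁ + n) * ‖x n‖ ^ 2 := by
    intro n
    have h := congrArg (fun z : ℂ => ‖z‖ ^ 2) (hx n)
    simp only [norm_mul, mul_pow, Complex.norm_real, Real.norm_eq_abs, sq_abs,
      wSeq_sq h₁, wSeq_sq h₂] at h
    push_cast at h
    have p1 : 0 < lam₁ + (n : ℝ) := by positivity
    have p2 : 0 < lam₂ + ((n : ℝ) + d) := by positivity
    field_simp at h
    linarith
  obtain ⟨ε, hε, hε2⟩ : ∃ ε : ℝ, 0 < ε ∧ 2 + lam₁ - lam₂ = 2 * ε :=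
    ⟨(2 + lam₁ - lam₂) / 2, by linarith, by ring⟩
  obtain ⟨N, hN⟩ := exists_nat_ge (((1 + ε) * (lam₂ + d)) / ε)
  have hlim : Tendsto (fun n : ℕ => ‖x n‖ ^ 2 * (n : ℝ) ^ 2) atTop atTop := by
    refine tendsto_atTop_of_one_add_div_mul_le (N := N + 1) hε ?_ ?_
    · have := norm_pos_iff.2 (hne (N + 1))
      positivity
    · intro n hn
      have hn' : (1 + ε) * (lam₂ + d) ≤ n * ε := by
        rw [div_le_iff₀ hε] at hN
        have : (N : ℝ) ≤ n := by exact_mod_cast (by omega : N ≤ n)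
        nlinarith
      have p2 : 0 < lam₂ + ((n : ℝ) + d) := by positivity
      have p1 : 0 < (n : ℝ) + 1 := by positivity
      have hpoly : (n : ℝ) ^ 2 * (n + 1 + ε) * (lam₂ + (n + d)) ≤
          (n + d + 1) * (lam₁ + n) * (n + 1) ^ 2 := by
        have hrest : 0 ≤ (d + 1 + 2 * (d + 1 + lam₁) + (d + 1) * lam₁ - d) * (n : ℝ) ^ 2 +
            ((d + 1 + lam₁) + 2 * (d + 1) * lam₁) * n + (d + 1) * lam₁ := by
          have : (0 : ℝ) ≤ d + 1 + 2 * (d + 1 + lam₁) + (d + 1) * lam₁ - d := by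
            have : (0 : ℝ) ≤ 1 + 2 * (d + 1 + lam₁) + (d + 1) * lam₁ := by positivity
            linarith
          positivity
        have hmul := mul_le_mul_of_nonneg_left hn' (sq_nonneg (n : ℝ))
        have hlam : lam₂ = 2 + lam₁ - 2 * ε := by linarith
        subst hlam
        linear_combination hrest + hmul
      have hx2 : ‖x (n + 1)‖ ^ 2 =
          (n + d + 1) * (lam₁ + n) * ‖x n‖ ^ 2 / ((n + 1) * (lam₂ + (n + d))) := by
        rw [eq_div_iff (by positivity), ← hsq n]
        ring
      rw [hx2]
      push_cast
      have hgoal : (1 + ε / ((n : ℝ) + 1)) * (‖x n‖ ^ 2 * (n : ℝ) ^ 2) =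
          ((n : ℝ) ^ 2 * (n + 1 + ε) * (lam₂ + (n + d))) * ‖x n‖ ^ 2 /
            ((n + 1) * (lam₂ + (n + d))) := by
        field_simp
      rw [hgoal, div_mul_eq_mul_div]
      gcongr ?_ / _
      linarith [mul_le_mul_of_nonneg_right hpoly (sq_nonneg ‖x n‖)]
  obtain ⟨M, hM⟩ := exists_nat_ge (2 * ‖c‖)
  obtain ⟨n, hn, hMn⟩ :=
    ((hlim.eventually_gt_atTop (4 * C ^ 2)).and (eventually_ge_atTop M)).exists
  have hcn : (n : ℝ) / 2 ≤ ‖c + n‖ := by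
    have h := norm_sub_le (c + n) c
    rw [add_sub_cancel_left, Complex.norm_natCast] at h
    have : (M : ℝ) ≤ n := by exact_mod_cast hMn
    linarith
  have hb : ‖x n‖ * (n / 2) ≤ C :=
    (mul_le_mul_of_nonneg_left hcn (norm_nonneg _)).trans (by simpa using hC n)
  have hb2 := pow_le_pow_left₀ (by positivity) hb 2
  linarith [show (‖x n‖ * ((n : ℝ) / 2)) ^ 2 = ‖x n‖ ^ 2 * (n : ℝ) ^ 2 / 4 by ring]

theorem HilbertBasis.inner_backwardShift {H : Type*} [NormedAddCommGroup H]
    [InnerProductSpace ℂ H] (e : HilbertBasis ℕ ℂ H) {A : H →L[ℂ] H} {a : ℕ → ℂ}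
    (hA0 : A (e 0) = 0) (hA : ∀ n : ℕ, A (e (n + 1)) = a n • e n) (i : ℕ) (v : H) :
    inner ℂ (e i) (A v) = a i * inner ℂ (e (i + 1)) v := by
  have key : (innerSL ℂ (e i)).comp A = a i • innerSL ℂ (e (i + 1)) := by
    refine ContinuousLinearMap.ext_on
      (Submodule.dense_iff_topologicalClosure_eq_top.2 e.dense_span) ?_
    rintro _ ⟨j, rfl⟩
    cases j with
    | zero => simp [hA0, orthonormal_iff_ite.1 e.orthonormal]
    | succ j =>
      by_cases hij : i = j <;>
        simp [hA, orthonormal_iff_ite.1 e.orthonormal, e.orthonormal.norm_eq_one, hij]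
  simpa using congrArg (fun f : H →L[ℂ] ℂ => f v) key

theorem HilbertBasis.eq_zero_of_inner_eq_zero {ι H : Type*} [NormedAddCommGroup H]
    [InnerProductSpace ℂ H] (e : HilbertBasis ι ℂ H) {X : H →L[ℂ] H}
    (h : ∀ i j, inner ℂ (e i) (X (e j)) = 0) : X = 0 := by
  refine ContinuousLinearMap.ext_on
    (Submodule.dense_iff_topologicalClosure_eq_top.2 e.dense_span) ?_
  rintro _ ⟨j, rfl⟩
  apply e.repr.injective
  ext i
  simp [e.repr_apply_apply, h]

theorem HilbertBasis.norm_inner_apply_le {ι H : Type*} [NormedAddCommGroup H]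
    [InnerProductSpace ℂ H] (e : HilbertBasis ι ℂ H) (X : H →L[ℂ] H) (i j : ι) :
    ‖inner ℂ (e i) (X (e j))‖ ≤ ‖X‖ := by
  have h := (norm_inner_le_norm (𝕜 := ℂ) (e i) (X (e j))).trans
    (mul_le_mul_of_nonneg_left (X.le_opNorm (e j)) (norm_nonneg _))
  simpa [e.orthonormal.norm_eq_one] using h

theorem propertyH_of_kernel_shifts
    {H : Type*} [NormedAddCommGroup H] [InnerProductSpace ℂ H] [CompleteSpace H]
    (lam₁ lam₂ : ℝ) (h₁ : 0 < lam₁) (h₂ : 0 < lam₂) (hdiff : lam₂ - lam₁ < 2)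
    (e : HilbertBasis ℕ ℂ H) (A B : H →L[ℂ] H)
    (hA0 : A (e 0) = 0) (hB0 : B (e 0) = 0)
    (hA : ∀ n : ℕ, A (e (n + 1)) = (wSeq lam₁ n : ℂ) • e n)
    (hB : ∀ n : ℕ, B (e (n + 1)) = (wSeq lam₂ n : ℂ) • e n) :
    PropertyH A B := by
  rintro X hX ⟨Z, hZ⟩
  have ha : ∀ n, (wSeq lam₁ n : ℂ) ≠ 0 := fun n => by exact_mod_cast (wSeq_pos h₁ n).ne'
  have hwA : ∀ n, ‖(wSeq lam₁ n : ℂ)‖ ≤ ‖A‖ := fun n => by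
    simpa [hA, norm_smul, e.orthonormal.norm_eq_one] using A.le_opNorm (e (n + 1))
  have hwB : ∀ n, ‖(wSeq lam₂ n : ℂ)‖ ≤ ‖B‖ := fun n => by
    simpa [hB, norm_smul, e.orthonormal.norm_eq_one] using B.le_opNorm (e (n + 1))
  have hshift := e.inner_backwardShift hA0 hA
  have hX' : ∀ v, A (X v) = X (B v) := fun v => congrArg (fun f : H →L[ℂ] H => f v) hX
  have hZ' : ∀ v, X v = A (Z v) - Z (B v) := fun v => congrArg (fun f : H →L[ℂ] H => f v) hZ
  have hX0 : ∀ i, inner ℂ (e (i + 1)) (X (e 0)) = 0 := fun i => by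
    have h := hshift i (X (e 0))
    rw [hX', hB0, map_zero, inner_zero_right] at h
    exact (mul_eq_zero.1 h.symm).resolve_left (ha i)
  have hXs : ∀ i j, (wSeq lam₁ i : ℂ) * inner ℂ (e (i + 1)) (X (e (j + 1))) =
      (wSeq lam₂ j : ℂ) * inner ℂ (e i) (X (e j)) := fun i j => by
    rw [← hshift, hX', hB, map_smul, inner_smul_right]
  have hZ0 : ∀ i, inner ℂ (e i) (X (e 0)) =
      (wSeq lam₁ i : ℂ) * inner ℂ (e (i + 1)) (Z (e 0)) := fun i => by
    rw [hZ', hB0, map_zero Z, sub_zero, hshift]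
  have hZs : ∀ i j, inner ℂ (e i) (X (e (j + 1))) =
      (wSeq lam₁ i : ℂ) * inner ℂ (e (i + 1)) (Z (e (j + 1))) -
        (wSeq lam₂ j : ℂ) * inner ℂ (e i) (Z (e j)) := fun i j => by
    rw [hZ', inner_sub_right, hshift, hB, map_smul, inner_smul_right]
  have hrow : ∀ d, inner ℂ (e 0) (X (e d)) = 0 := by
    intro d
    cases d with
    | zero =>
      have hdiag : ∀ n : ℕ, inner ℂ (e n) (X (e n)) * (1 + n) =
          (wSeq lam₁ n : ℂ) * inner ℂ (e (n + 1)) (Z (e n)) := by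
        intro n
        induction n with
        | zero => simpa using hZ0 0
        | succ n ih =>
          apply mul_left_cancel₀ (ha n)
          push_cast
          linear_combination (n + 1 : ℂ) * hXs n n + (wSeq lam₁ n : ℂ) * hZs (n + 1) n +
            (wSeq lam₂ n : ℂ) * ih
      refine eq_zero_of_wSeq_recurrence h₁ h₂ hdiff 0 (x := fun n => inner ℂ (e n) (X (e n)))
        (fun n => hXs n n) (c := 1) (C := ‖A‖ * ‖Z‖) fun n => ?_
      rw [hdiag, norm_mul]
      exact mul_le_mul (hwA n) (e.norm_inner_apply_le Z _ _) (norm_nonneg _) (norm_nonneg _)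
    | succ d =>
      by_contra hne
      set c : ℂ := (wSeq lam₂ d : ℂ) * inner ℂ (e 0) (Z (e d)) / inner ℂ (e 0) (X (e (d + 1)))
        with hc
      have hdiag : ∀ n : ℕ, inner ℂ (e n) (X (e (n + d + 1))) * (c + n) =
          (wSeq lam₂ (n + d) : ℂ) * inner ℂ (e n) (Z (e (n + d))) := by
        intro n
        induction n with
        | zero =>
          simp only [zero_add, Nat.cast_zero, add_zero]
          rw [hc, mul_div_cancel₀ _ hne]
        | succ n ih =>
          rw [show n + 1 + d = n + d + 1 by ring]
          apply mul_left_cancel₀ (ha n)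
          push_cast
          linear_combination (c + n + 1 : ℂ) * hXs n (n + d + 1) +
            (wSeq lam₂ (n + d + 1) : ℂ) * hZs n (n + d) + (wSeq lam₂ (n + d + 1) : ℂ) * ih
      refine hne ?_
      have := eq_zero_of_wSeq_recurrence h₁ h₂ hdiff (d + 1)
        (x := fun n => inner ℂ (e n) (X (e (n + d + 1))))
        (fun n => by
          have := hXs n (n + d + 1)
          rwa [show n + d + 1 + 1 = n + 1 + d + 1 by ring] at this)
        (c := c) (C := ‖B‖ * ‖Z‖) fun n => by
          rw [hdiag, norm_mul]
          exact mul_le_mul (hwB _) (e.norm_inner_apply_le Z _ _) (norm_nonneg _) (norm_nonneg _)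
      simpa using this
  refine e.eq_zero_of_inner_eq_zero fun i => ?_
  induction i with
  | zero => exact hrow
  | succ i ih =>
    intro j
    cases j with
    | zero => exact hX0 i
    | succ j =>
      have h := hXs i j
      rw [ih, mul_zero] at h
      exact (mul_eq_zero.1 h).resolve_left (ha i)
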